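/- Let u ∈ H^2(R^N) be a weak solution of Δ²u + μΔu − λu = |u|^{p−2}u with λ < 0, μ ∈ R and 2 < p < 2N/(N−4)⁺. Then u satisfies the Pohozaev identity 2||Δu||_2² − μ||∇u||_2² − 2γ_p||u||_p^p = 0, where γ_p = N(p−2)/(4p). -/

import Mathlib

open MeasureTheory Filter Topology

noncomputable def lapl {N : ℕ} (u : EuclideanSpace ℝ (Fin N) → ℝ)
    (x : EuclideanSpace ℝ (Fin N)) : ℝ :=
  ∑ i : Fin N, iteratedFDeriv ℝ 2 u x ![EuclideanSpace.single i 1, EuclideanSpace.single i 1]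

section PartialDerivatives

variable {N : ℕ}

/-- The `i`-th partial derivative of a function on Euclidean space. -/
noncomputable def pderiv (i : Fin N) (f : EuclideanSpace ℝ (Fin N) → ℝ)
    (x : EuclideanSpace ℝ (Fin N)) : ℝ :=
  fderiv ℝ f x (EuclideanSpace.single i 1)

variable {f g k u χ : EuclideanSpace ℝ (Fin N) → ℝ}

lemma ContDiff.pderiv {m n : WithTop ℕ∞} (hf : ContDiff ℝ n f) (hmn : m + 1 ≤ n) (i : Fin N) :
    ContDiff ℝ m (pderiv i f) :=
  (hf.fderiv_right hmn).clm_apply contDiff_const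

lemma ContDiff.continuous_pderiv (hf : ContDiff ℝ 1 f) (i : Fin N) :
    Continuous (_root_.pderiv i f) :=
  (hf.pderiv (m := 0) (by norm_num) i).continuous

lemma HasCompactSupport.pderiv (hf : HasCompactSupport f) (i : Fin N) :
    HasCompactSupport (pderiv i f) :=
  hf.fderiv_apply ℝ _

lemma pderiv_mul (hf : ContDiff ℝ 1 f) (hg : ContDiff ℝ 1 g) (i : Fin N)
    (x : EuclideanSpace ℝ (Fin N)) :
    pderiv i (fun y => f y * g y) x = pderiv i f x * g x + f x * pderiv i g x := by
  unfold pderiv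
  rw [fderiv_fun_mul (hf.differentiable one_ne_zero x) (hg.differentiable one_ne_zero x)]
  simp
  ring

lemma pderiv_sum {ι : Type*} {s : Finset ι} {F : ι → EuclideanSpace ℝ (Fin N) → ℝ}
    (hF : ∀ j ∈ s, ContDiff ℝ 1 (F j)) (i : Fin N) (x : EuclideanSpace ℝ (Fin N)) :
    pderiv i (fun y => ∑ j ∈ s, F j y) x = ∑ j ∈ s, pderiv i (F j) x := by
  unfold pderiv
  rw [fderiv_fun_sum fun j hj => (hF j hj).differentiable one_ne_zero x]
  simp

lemma pderiv_pderiv (hf : ContDiff ℝ 2 f) (i j : Fin N) (x : EuclideanSpace ℝ (Fin N)) :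
    pderiv i (pderiv j f) x =
      fderiv ℝ (fderiv ℝ f) x (EuclideanSpace.single i 1) (EuclideanSpace.single j 1) := by
  have h : DifferentiableAt ℝ (fderiv ℝ f) x :=
    (hf.fderiv_right (m := 1) (by norm_num)).differentiable one_ne_zero x
  have h' := (h.hasFDerivAt.clm_apply (hasFDerivAt_const (EuclideanSpace.single j (1 : ℝ)) x)).fderiv
  change fderiv ℝ (fun y => fderiv ℝ f y (EuclideanSpace.single j 1)) x _ = _
  rw [h']
  simp

lemma pderiv_comm (hf : ContDiff ℝ 2 f) (i j : Fin N) :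
    pderiv i (pderiv j f) = pderiv j (pderiv i f) := by
  ext x
  rw [pderiv_pderiv hf, pderiv_pderiv hf]
  exact hf.contDiffAt.isSymmSndFDerivAt (by simp) _ _

lemma pderiv_const_mul_comp_smul (hk : ContDiff ℝ 1 k) (c ε : ℝ) (i : Fin N) :
    pderiv i (fun x => c * k (ε • x)) = fun x => c * ε * pderiv i k (ε • x) := by
  ext x
  have h := ((hk.differentiable one_ne_zero (ε • x)).hasFDerivAt.comp x
    ((hasFDerivAt_id x).const_smul ε)).const_mul c
  change fderiv ℝ (fun x => c * k (ε • x)) x _ = _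
  rw [HasFDerivAt.fderiv (f := fun x => c * k (ε • x)) h]
  simp [pderiv, mul_assoc]

lemma lapl_eq_sum_pderiv (hf : ContDiff ℝ 2 f) :
    lapl f = fun x => ∑ i, pderiv i (pderiv i f) x := by
  ext x
  simp [lapl, iteratedFDeriv_two_apply, pderiv_pderiv hf]

lemma ContDiff.lapl {m n : WithTop ℕ∞} (hf : ContDiff ℝ n f) (hmn : m + 1 + 1 ≤ n) :
    ContDiff ℝ m (lapl f) := by
  rw [lapl_eq_sum_pderiv (hf.of_le (le_trans (by rw [add_assoc, one_add_one_eq_two]; simp) hmn))]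
  exact ContDiff.sum fun i _ => (hf.pderiv hmn i).pderiv le_rfl i

lemma lapl_pderiv (hf : ContDiff ℝ 3 f) (i : Fin N) :
    lapl (pderiv i f) = pderiv i (lapl f) := by
  have h2 : ContDiff ℝ 2 f := hf.of_le (by norm_num)
  have hp (j : Fin N) : ContDiff ℝ 2 (pderiv j f) := hf.pderiv (by norm_num) j
  ext x
  rw [lapl_eq_sum_pderiv (hp i), lapl_eq_sum_pderiv h2,
    pderiv_sum fun j _ => (hp j).pderiv (by norm_num) j]
  refine Finset.sum_congr rfl fun j _ => ?_
  rw [pderiv_comm (hp j) i j, pderiv_comm h2 i j]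

lemma norm_gradient_sq (f : EuclideanSpace ℝ (Fin N) → ℝ) (x : EuclideanSpace ℝ (Fin N)) :
    ‖gradient f x‖ ^ 2 = ∑ i, pderiv i f x ^ 2 := by
  rw [EuclideanSpace.real_norm_sq_eq]
  refine Finset.sum_congr rfl fun i _ => ?_
  have h : pderiv i f x = inner ℝ (gradient f x) (EuclideanSpace.single i 1) := by
    rw [inner_gradient_left, pderiv]
  rw [h, EuclideanSpace.inner_single_right]
  simp

end PartialDerivatives

section IntegrationByParts

variable {N : ℕ} {f g u χ : EuclideanSpace ℝ (Fin N) → ℝ}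

lemma integrable_mul_of_hasCompactSupport (hχ : Continuous χ) (hc : HasCompactSupport χ)
    (hf : Continuous f) : Integrable (fun x => χ x * f x) :=
  (hχ.mul hf).integrable_of_hasCompactSupport hc.mul_right

lemma integrable_mul_mul_of_hasCompactSupport (hχ : Continuous χ) (hc : HasCompactSupport χ)
    (hf : Continuous f) (hg : Continuous g) : Integrable (fun x => χ x * (f x * g x)) :=
  integrable_mul_of_hasCompactSupport hχ hc (hf.mul hg)

lemma integral_mul_pderiv (hχ : ContDiff ℝ 1 χ) (hc : HasCompactSupport χ) (hf : ContDiff ℝ 1 f)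
    (i : Fin N) : ∫ x, χ x * pderiv i f x = -∫ x, pderiv i χ x * f x :=
  integral_mul_fderiv_eq_neg_fderiv_mul_of_integrable
    (integrable_mul_of_hasCompactSupport (hχ.continuous_pderiv i) (hc.pderiv i) hf.continuous)
    (integrable_mul_of_hasCompactSupport hχ.continuous hc (hf.continuous_pderiv i))
    (integrable_mul_of_hasCompactSupport hχ.continuous hc hf.continuous)
    (fun x _ => hχ.differentiable one_ne_zero x) (fun x _ => hf.differentiable one_ne_zero x)

lemma integral_mul_mul_pderiv_self (hχ : ContDiff ℝ 1 χ) (hc : HasCompactSupport χ)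
    (hg : ContDiff ℝ 1 g) (i : Fin N) :
    ∫ x, χ x * (g x * pderiv i g x) = -(1 / 2) * ∫ x, pderiv i χ x * g x ^ 2 := by
  have h := integral_mul_pderiv hχ hc (hg.pow 2) i
  have e (x) : pderiv i (fun y => g y ^ 2) x = 2 * (g x * pderiv i g x) := by
    simp only [pow_two, pderiv_mul hg hg]; ring
  simp only [e, mul_left_comm _ (2 : ℝ), integral_const_mul] at h
  linarith

lemma integral_mul_pderiv_mul_abs_rpow {p : ℝ} (hp : 1 < p) (hχ : ContDiff ℝ 1 χ)
    (hc : HasCompactSupport χ) (hu : ContDiff ℝ 1 u) (i : Fin N) :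
    ∫ x, χ x * (pderiv i u x * (|u x| ^ (p - 2) * u x)) =
      -(1 / p) * ∫ x, pderiv i χ x * |u x| ^ p := by
  have hC : ContDiff ℝ 1 (fun x => |u x| ^ p) := (contDiff_norm_rpow hp).comp hu
  have h := integral_mul_pderiv hχ hc hC i
  have e (x) : pderiv i (fun y => |u y| ^ p) x = p * (pderiv i u x * (|u x| ^ (p - 2) * u x)) := by
    have h' := (hasDerivAt_abs_rpow (u x) hp).comp_hasFDerivAt x
      (hu.differentiable one_ne_zero x).hasFDerivAt
    change fderiv ℝ (fun y => |u y| ^ p) x _ = _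
    rw [HasFDerivAt.fderiv (f := fun y => |u y| ^ p) h']
    simp [pderiv]
    ring
  simp only [e, mul_left_comm _ p, integral_const_mul] at h
  have : p ≠ 0 := by linarith
  rw [neg_mul, ← mul_neg, ← h, ← mul_assoc, one_div_mul_cancel this, one_mul]

lemma integral_mul_mul_lapl (hχ : ContDiff ℝ 1 χ) (hc : HasCompactSupport χ)
    (hg : ContDiff ℝ 1 g) (hf : ContDiff ℝ 2 f) :
    ∫ x, χ x * (g x * lapl f x) =
      -(∑ j, ∫ x, pderiv j χ x * (g x * pderiv j f x)) -
        ∑ j, ∫ x, χ x * (pderiv j g x * pderiv j f x) := by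
  have hf' (j : Fin N) : ContDiff ℝ 1 (pderiv j f) := hf.pderiv (by norm_num) j
  simp only [lapl_eq_sum_pderiv hf, Finset.mul_sum]
  rw [integral_finsetSum _ fun j _ => integrable_mul_mul_of_hasCompactSupport hχ.continuous hc
    hg.continuous ((hf' j).continuous_pderiv j), ← Finset.sum_neg_distrib,
    ← Finset.sum_sub_distrib]
  refine Finset.sum_congr rfl fun j _ => ?_
  have h := integral_mul_pderiv (hχ.mul hg) hc.mul_right (hf' j) j
  simp only [pderiv_mul hχ hg, add_mul, mul_assoc] at h
  rw [h, integral_add]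
  · ring
  · exact integrable_mul_of_hasCompactSupport (hχ.continuous_pderiv j) (hc.pderiv j)
      (hg.continuous.mul (hf' j).continuous)
  · exact integrable_mul_of_hasCompactSupport hχ.continuous hc
      ((hg.continuous_pderiv j).mul (hf' j).continuous)

lemma integral_mul_mul_lapl' (hχ : ContDiff ℝ 2 χ) (hc : HasCompactSupport χ)
    (hg : ContDiff ℝ 2 g) (hf : ContDiff ℝ 2 f) :
    ∫ x, χ x * (g x * lapl f x) =
      (∑ j, ∫ x, pderiv j (pderiv j χ) x * (g x * f x)) +
        2 * (∑ j, ∫ x, pderiv j χ x * (pderiv j g x * f x)) + ∫ x, χ x * (lapl g x * f x) := by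
  have hχ1 : ContDiff ℝ 1 χ := hχ.of_le (by norm_num)
  have hg1 : ContDiff ℝ 1 g := hg.of_le (by norm_num)
  have hf1 : ContDiff ℝ 1 f := hf.of_le (by norm_num)
  have hχ' (j : Fin N) : ContDiff ℝ 1 (pderiv j χ) := hχ.pderiv (by norm_num) j
  have h1 := integral_mul_mul_lapl hχ1 hc hg1 hf
  have h2 := integral_mul_mul_lapl hχ1 hc hf1 hg
  have h3 (j : Fin N) : (∫ x, pderiv j χ x * (g x * pderiv j f x)) =
      -(∫ x, pderiv j (pderiv j χ) x * (g x * f x)) -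
        ∫ x, pderiv j χ x * (pderiv j g x * f x) := by
    have h := integral_mul_pderiv ((hχ' j).mul hg1) (hc.pderiv j).mul_right hf1 j
    simp only [pderiv_mul (hχ' j) hg1, add_mul, mul_assoc] at h
    rw [h, integral_add]
    · ring
    · exact integrable_mul_mul_of_hasCompactSupport ((hχ' j).continuous_pderiv j)
        ((hc.pderiv j).pderiv j)
        hg1.continuous hf1.continuous
    · exact integrable_mul_mul_of_hasCompactSupport (hχ' j).continuous (hc.pderiv j)
        (hg1.continuous_pderiv j) hf1.continuous
  simp only [h3, Finset.sum_sub_distrib, Finset.sum_neg_distrib] at h1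
  simp only [mul_comm (f _)] at h2
  simp only [mul_comm (pderiv _ f _) (pderiv _ g _)] at h2
  linarith

lemma integral_mul_pderiv_mul_lapl (hχ : ContDiff ℝ 1 χ) (hc : HasCompactSupport χ)
    (hu : ContDiff ℝ 2 u) (i : Fin N) :
    ∫ x, χ x * (pderiv i u x * lapl u x) =
      -(∑ j, ∫ x, pderiv j χ x * (pderiv i u x * pderiv j u x)) +
        1 / 2 * ∑ j, ∫ x, pderiv i χ x * pderiv j u x ^ 2 := by
  have hu' (j : Fin N) : ContDiff ℝ 1 (pderiv j u) := hu.pderiv (by norm_num) j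
  rw [integral_mul_mul_lapl hχ hc (hu' i) hu, Finset.mul_sum, sub_eq_add_neg,
    ← Finset.sum_neg_distrib (f := fun j => ∫ x, χ x * (pderiv j (pderiv i u) x * pderiv j u x))]
  congr 1
  refine Finset.sum_congr rfl fun j _ => ?_
  have h := integral_mul_mul_pderiv_self hχ hc (hu' j) i
  simp only [pderiv_comm hu i j, mul_comm (pderiv j u _)] at h
  linarith

lemma integral_mul_pderiv_mul_lapl_lapl (hχ : ContDiff ℝ 2 χ) (hc : HasCompactSupport χ)
    (hu : ContDiff ℝ 4 u) (i : Fin N) :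
    ∫ x, χ x * (pderiv i u x * lapl (lapl u) x) =
      (∑ j, ∫ x, pderiv j (pderiv j χ) x * (pderiv i u x * lapl u x)) +
        2 * (∑ j, ∫ x, pderiv j χ x * (pderiv j (pderiv i u) x * lapl u x)) -
          1 / 2 * ∫ x, pderiv i χ x * lapl u x ^ 2 := by
  have hv : ContDiff ℝ 2 (lapl u) := hu.lapl (by norm_num)
  rw [integral_mul_mul_lapl' hχ hc (hu.pderiv (by norm_num) i) hv,
    lapl_pderiv (hu.of_le (by norm_num))]
  have h := integral_mul_mul_pderiv_self (hχ.of_le (by norm_num)) hc (hv.of_le (by norm_num)) i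
  simp only [mul_comm (lapl u _)] at h
  linarith

lemma sum_integral_mul_pderiv_pderiv_sq (hχ : ContDiff ℝ 2 χ) (hc : HasCompactSupport χ)
    (hu : ContDiff ℝ 3 u) :
    ∑ i, ∑ j, ∫ x, χ x * pderiv j (pderiv i u) x ^ 2 =
      (∑ i, ∑ j, 1 / 2 * ∫ x, pderiv j (pderiv j χ) x * pderiv i u x ^ 2) +
        (∑ i, ∫ x, pderiv i χ x * (pderiv i u x * lapl u x)) + ∫ x, χ x * lapl u x ^ 2 := by
  have hχ1 : ContDiff ℝ 1 χ := hχ.of_le (by norm_num)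
  have hu2 : ContDiff ℝ 2 u := hu.of_le (by norm_num)
  have hu' (j : Fin N) : ContDiff ℝ 2 (pderiv j u) := hu.pderiv (by norm_num) j
  have hu1 (j : Fin N) : ContDiff ℝ 1 (pderiv j u) := (hu' j).of_le (by norm_num)
  have hv : ContDiff ℝ 1 (lapl u) := hu.lapl (by norm_num)
  have hsum : ∫ x, χ x * lapl u x ^ 2 = ∑ i, ∫ x, χ x * (pderiv i (pderiv i u) x * lapl u x) := by
    rw [← integral_finsetSum _ fun i _ => integrable_mul_mul_of_hasCompactSupport hχ.continuous hc
        ((hu1 i).continuous_pderiv i) hv.continuous]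
    refine integral_congr_ae (Eventually.of_forall fun x => ?_)
    simp only [← Finset.mul_sum, ← Finset.sum_mul, pow_two]
    congr 2
    rw [lapl_eq_sum_pderiv hu2]
  rw [hsum, ← Finset.sum_add_distrib, ← Finset.sum_add_distrib]
  refine Finset.sum_congr rfl fun i _ => ?_
  have h1 := integral_mul_mul_lapl hχ1 hc (hu1 i) (hu' i)
  have h2 (j : Fin N) := integral_mul_mul_pderiv_self (hχ.pderiv (m := 1) (by norm_num) j)
    (hc.pderiv j) (hu1 i) j
  have h3 := integral_mul_pderiv (hχ1.mul (hu1 i)) hc.mul_right hv i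
  simp only [pderiv_mul hχ1 (hu1 i), add_mul, mul_assoc] at h3
  rw [integral_add (integrable_mul_mul_of_hasCompactSupport (hχ1.continuous_pderiv i) (hc.pderiv i)
        (hu1 i).continuous hv.continuous)
    (integrable_mul_mul_of_hasCompactSupport hχ1.continuous hc
        ((hu1 i).continuous_pderiv i) hv.continuous)] at h3
  rw [lapl_pderiv hu, h3] at h1
  simp only [h2, ← pow_two, neg_mul, Finset.sum_neg_distrib] at h1
  linarith

end IntegrationByParts

section Scaling

variable {N : ℕ} {g k u : EuclideanSpace ℝ (Fin N) → ℝ}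

lemma HasCompactSupport.const_mul_comp_smul (hc : HasCompactSupport k) (c : ℝ) {ε : ℝ}
    (hε : ε ≠ 0) : HasCompactSupport (fun x => c * k (ε • x)) :=
  (hc.comp_smul hε).mul_left

lemma ContDiff.const_mul_comp_smul {n : WithTop ℕ∞} (hk : ContDiff ℝ n k) (c ε : ℝ) :
    ContDiff ℝ n (fun x => c * k (ε • x)) :=
  contDiff_const.mul (hk.comp (contDiff_const_smul ε))

lemma tendsto_integral_const_mul_comp_smul_mul (hk : Continuous k) (hc : HasCompactSupport k)
    (hg : Integrable g) {c : ℝ → ℝ} {a : ℝ} (hca : Tendsto c (𝓝[>] 0) (𝓝 a)) :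
    Tendsto (fun ε : ℝ => ∫ x, c ε * k (ε • x) * g x) (𝓝[>] 0) (𝓝 (a * k 0 * ∫ x, g x)) := by
  simp only [mul_assoc, integral_const_mul]
  refine hca.mul ?_
  rw [← integral_const_mul]
  obtain ⟨C, hC⟩ := hc.exists_bound_of_continuous hk
  refine tendsto_integral_filter_of_dominated_convergence (fun x => C * ‖g x‖) ?_ ?_ ?_ ?_
  · exact Eventually.of_forall fun ε =>
      (hk.comp (continuous_const_smul ε)).aestronglyMeasurable.mul hg.aestronglyMeasurable
  · refine Eventually.of_forall fun ε => Eventually.of_forall fun x => ?_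
    rw [norm_mul]
    exact mul_le_mul_of_nonneg_right (hC _) (norm_nonneg _)
  · exact hg.norm.const_mul C
  · refine Eventually.of_forall fun x => Tendsto.mul_const _ ?_
    have h : Continuous fun ε : ℝ => k (ε • x) := hk.comp (continuous_id.smul continuous_const)
    simpa using (h.tendsto 0).mono_left nhdsWithin_le_nhds

lemma tendsto_id_nhdsGT_zero : Tendsto (fun ε : ℝ => ε) (𝓝[>] 0) (𝓝 0) :=
  tendsto_id.mono_left nhdsWithin_le_nhds

lemma tendsto_inv_mul_self_nhdsGT_zero : Tendsto (fun ε : ℝ => ε⁻¹ * ε) (𝓝[>] 0) (𝓝 1) := by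
  refine tendsto_const_nhds.congr' ?_
  filter_upwards [self_mem_nhdsWithin] with ε hε
  exact (inv_mul_cancel₀ (ne_of_gt hε)).symm

lemma integrable_mul_of_integrable_sq {f g : EuclideanSpace ℝ (Fin N) → ℝ} (hf : Continuous f)
    (hg : Continuous g) (hf2 : Integrable fun x => f x ^ 2) (hg2 : Integrable fun x => g x ^ 2) :
    Integrable fun x => f x * g x :=
  ((memLp_two_iff_integrable_sq hf.aestronglyMeasurable).2 hf2).integrable_mul
    ((memLp_two_iff_integrable_sq hg.aestronglyMeasurable).2 hg2)

/-- A smooth cutoff function, equal to `1` on the unit ball. -/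
noncomputable def cutoff (N : ℕ) : ContDiffBump (0 : EuclideanSpace ℝ (Fin N)) :=
  ⟨1, 2, one_pos, one_lt_two⟩

lemma cutoff_zero : cutoff N 0 = 1 :=
  (cutoff N).one_of_mem_closedBall (by simp [cutoff])

lemma integrable_pderiv_pderiv_sq (hu : ContDiff ℝ 3 u)
    (h1 : ∀ i, Integrable fun x => pderiv i u x ^ 2) (h2 : Integrable fun x => lapl u x ^ 2)
    (i j : Fin N) : Integrable fun x => pderiv j (pderiv i u) x ^ 2 := by
  have hb : ContDiff ℝ 2 (cutoff N) := (cutoff N).contDiff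
  have hb1 : ContDiff ℝ 1 (cutoff N) := (cutoff N).contDiff
  have hbc := (cutoff N).hasCompactSupport
  have hb' (j : Fin N) : ContDiff ℝ 1 (pderiv j (cutoff N)) := hb.pderiv (by norm_num) j
  have hu' (j : Fin N) : ContDiff ℝ 2 (pderiv j u) := hu.pderiv (by norm_num) j
  have hcont (i j : Fin N) : Continuous fun x => pderiv j (pderiv i u) x ^ 2 :=
    (((hu' i).of_le (by norm_num)).continuous_pderiv j).pow 2
  have hv : Continuous (lapl u) := (hu.lapl (m := 1) (by norm_num)).continuous
  have hid := tendsto_id_nhdsGT_zero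
  have hlim := ((tendsto_finsetSum Finset.univ fun i _ => tendsto_finsetSum Finset.univ fun j _ =>
    (tendsto_integral_const_mul_comp_smul_mul ((hb' j).continuous_pderiv j)
      ((hbc.pderiv j).pderiv j) (h1 i) ((hid.const_mul 1).mul hid)).const_mul (1 / 2)).add
    (tendsto_finsetSum Finset.univ fun i _ =>
      tendsto_integral_const_mul_comp_smul_mul (hb1.continuous_pderiv i) (hbc.pderiv i)
        (integrable_mul_of_integrable_sq (hu' i).continuous hv (h1 i) h2) (hid.const_mul 1))).add
    (tendsto_integral_const_mul_comp_smul_mul hb.continuous hbc h2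
      (tendsto_const_nhds (x := (1 : ℝ))))
  obtain ⟨I, hbound⟩ := hlim.isBoundedUnder_le
  rw [eventually_map] at hbound
  refine (aecover_ball (x := 0) tendsto_inv_nhdsGT_zero).integrable_of_integral_bounded_of_nonneg_ae
    I (fun ε => ?_) (Eventually.of_forall fun x => sq_nonneg _) ?_
  · exact ((hcont i j).continuousOn.integrableOn_compact
      (isCompact_closedBall 0 ε⁻¹)).mono_set Metric.ball_subset_closedBall
  · filter_upwards [hbound, self_mem_nhdsWithin] with ε hε hpos
    refine le_trans ?_ hε
    have hpos : 0 < ε := hpos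
    have hχ := hb.const_mul_comp_smul 1 ε
    have hχc := hbc.const_mul_comp_smul 1 hpos.ne'
    have key := sum_integral_mul_pderiv_pderiv_sq hχ hχc hu
    simp only [pderiv_const_mul_comp_smul hb1, pderiv_const_mul_comp_smul (hb' _)] at key
    rw [← key]
    have hnn (i j : Fin N) (x) : 0 ≤ 1 * cutoff N (ε • x) * pderiv j (pderiv i u) x ^ 2 := by
      have := (cutoff N).nonneg (x := ε • x)
      positivity
    have hint : Integrable fun x => 1 * cutoff N (ε • x) * pderiv j (pderiv i u) x ^ 2 :=
      integrable_mul_of_hasCompactSupport hχ.continuous hχc (hcont i j)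
    calc ∫ x in Metric.ball 0 ε⁻¹, pderiv j (pderiv i u) x ^ 2
        = ∫ x in Metric.ball 0 ε⁻¹, 1 * cutoff N (ε • x) * pderiv j (pderiv i u) x ^ 2 := by
          refine setIntegral_congr_fun measurableSet_ball fun x hx => ?_
          have hx' : ε • x ∈ Metric.closedBall 0 (cutoff N).rIn := by
            rw [mem_closedBall_zero_iff, norm_smul, Real.norm_of_nonneg hpos.le]
            rw [mem_ball_zero_iff] at hx
            calc ε * ‖x‖ ≤ ε * ε⁻¹ := by gcongr
              _ = 1 := mul_inv_cancel₀ hpos.ne'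
          simp [(cutoff N).one_of_mem_closedBall hx']
      _ ≤ ∫ x, 1 * cutoff N (ε • x) * pderiv j (pderiv i u) x ^ 2 :=
          setIntegral_le_integral hint (Eventually.of_forall (hnn i j))
      _ ≤ ∑ j, ∫ x, 1 * cutoff N (ε • x) * pderiv j (pderiv i u) x ^ 2 :=
          Finset.single_le_sum
            (f := fun j => ∫ x, 1 * cutoff N (ε • x) * pderiv j (pderiv i u) x ^ 2)
            (fun j _ => integral_nonneg (hnn i j)) (Finset.mem_univ j)
      _ ≤ _ := Finset.single_le_sum
            (f := fun i => ∑ j, ∫ x, 1 * cutoff N (ε • x) * pderiv j (pderiv i u) x ^ 2)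
            (fun i _ => Finset.sum_nonneg fun j _ => integral_nonneg (hnn i j)) (Finset.mem_univ i)

end Scaling

section Equation

variable {N : ℕ} {u : EuclideanSpace ℝ (Fin N) → ℝ} {μ lam p : ℝ}

lemma integral_mul_mul_equation {w χ : EuclideanSpace ℝ (Fin N) → ℝ} (hp : 2 < p)
    (hu : ContDiff ℝ 4 u)
    (heq : ∀ x, lapl (lapl u) x + μ * lapl u x - lam * u x = |u x| ^ (p - 2) * u x)
    (hχ : Continuous χ) (hc : HasCompactSupport χ) (hw : Continuous w) :
    (∫ x, χ x * (w x * lapl (lapl u) x)) + μ * (∫ x, χ x * (w x * lapl u x)) -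
      lam * (∫ x, χ x * (w x * u x)) - ∫ x, χ x * (w x * (|u x| ^ (p - 2) * u x)) = 0 := by
  have hv : ContDiff ℝ 2 (lapl u) := hu.lapl (by norm_num)
  have hvv : Continuous (lapl (lapl u)) := (hv.lapl (m := 0) (by norm_num)).continuous
  have hf : Continuous fun x => |u x| ^ (p - 2) * u x :=
    (hu.continuous.abs.rpow_const fun x => Or.inr (by linarith)).mul hu.continuous
  have i1 := integrable_mul_mul_of_hasCompactSupport hχ hc hw hvv
  have i2 := integrable_mul_mul_of_hasCompactSupport hχ hc hw hv.continuous
  have i3 := integrable_mul_mul_of_hasCompactSupport hχ hc hw hu.continuous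
  have i4 := integrable_mul_mul_of_hasCompactSupport hχ hc hw hf
  have i12 : Integrable fun x => χ x * (w x * lapl (lapl u) x) + μ * (χ x * (w x * lapl u x)) :=
    i1.add (i2.const_mul μ)
  have i123 : Integrable fun x => χ x * (w x * lapl (lapl u) x) + μ * (χ x * (w x * lapl u x)) -
      lam * (χ x * (w x * u x)) := i12.sub (i3.const_mul lam)
  rw [← integral_const_mul, ← integral_const_mul, ← integral_add i1 (i2.const_mul μ),
    ← integral_sub i12 (i3.const_mul lam), ← integral_sub i123 i4]
  refine integral_eq_zero_of_ae (Eventually.of_forall fun x => ?_)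
  simp only [← heq x, Pi.zero_apply]
  ring

lemma energy_identity (hp : 2 < p) (hu : ContDiff ℝ 4 u)
    (h0 : Integrable fun x => u x ^ 2) (h1 : ∀ i, Integrable fun x => pderiv i u x ^ 2)
    (h2 : Integrable fun x => lapl u x ^ 2) (h3 : Integrable fun x => |u x| ^ p)
    (heq : ∀ x, lapl (lapl u) x + μ * lapl u x - lam * u x = |u x| ^ (p - 2) * u x) :
    (∫ x, lapl u x ^ 2) - μ * (∑ i, ∫ x, pderiv i u x ^ 2) - lam * (∫ x, u x ^ 2) -
      ∫ x, |u x| ^ p = 0 := by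
  have hb : ContDiff ℝ 2 (cutoff N) := (cutoff N).contDiff
  have hb1 : ContDiff ℝ 1 (cutoff N) := (cutoff N).contDiff
  have hbc := (cutoff N).hasCompactSupport
  have hb' (j : Fin N) : ContDiff ℝ 1 (pderiv j (cutoff N)) := hb.pderiv (by norm_num) j
  have hu2 : ContDiff ℝ 2 u := hu.of_le (by norm_num)
  have hu1 : ContDiff ℝ 1 u := hu.of_le (by norm_num)
  have hu' (j : Fin N) : Continuous (pderiv j u) := hu1.continuous_pderiv j
  have hv : ContDiff ℝ 2 (lapl u) := hu.lapl (by norm_num)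
  have hid := tendsto_id_nhdsGT_zero
  have hone := tendsto_const_nhds (x := (1 : ℝ)) (f := 𝓝[>] (0 : ℝ))
  have t1 := tendsto_finsetSum Finset.univ fun (j : Fin N) _ =>
    tendsto_integral_const_mul_comp_smul_mul ((hb' j).continuous_pderiv j)
      ((hbc.pderiv j).pderiv j) (integrable_mul_of_integrable_sq hu.continuous hv.continuous h0 h2)
      ((hid.const_mul 1).mul hid)
  have t2 := tendsto_finsetSum Finset.univ fun (j : Fin N) _ =>
    tendsto_integral_const_mul_comp_smul_mul (hb1.continuous_pderiv j) (hbc.pderiv j)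
      (integrable_mul_of_integrable_sq (hu' j) hv.continuous (h1 j) h2) (hid.const_mul 1)
  have t3 := tendsto_integral_const_mul_comp_smul_mul hb.continuous hbc h2 hone
  have t4 := tendsto_finsetSum Finset.univ fun (j : Fin N) _ =>
    tendsto_integral_const_mul_comp_smul_mul (hb1.continuous_pderiv j) (hbc.pderiv j)
      (integrable_mul_of_integrable_sq hu.continuous (hu' j) h0 (h1 j)) (hid.const_mul 1)
  have t5 := tendsto_finsetSum Finset.univ fun (j : Fin N) _ =>
    tendsto_integral_const_mul_comp_smul_mul hb.continuous hbc (h1 j) hone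
  have t6 := tendsto_integral_const_mul_comp_smul_mul hb.continuous hbc h0 hone
  have t7 := tendsto_integral_const_mul_comp_smul_mul hb.continuous hbc h3 hone
  have hlim := ((((t1.add (t2.const_mul 2)).add t3).add ((t4.neg.sub t5).const_mul μ)).sub
    (t6.const_mul lam)).sub t7
  have hzero := tendsto_nhds_unique_of_eventuallyEq hlim (tendsto_const_nhds (x := (0 : ℝ))) ?_
  · simp only [cutoff_zero, mul_zero, zero_mul, Finset.sum_const_zero, mul_one, one_mul] at hzero
    linarith
  · filter_upwards [self_mem_nhdsWithin] with ε (hε : 0 < ε)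
    have hχ := hb.const_mul_comp_smul 1 ε
    have hχc := hbc.const_mul_comp_smul 1 hε.ne'
    have key := integral_mul_mul_equation hp hu heq hχ.continuous hχc hu.continuous
    have hpow (x) : u x * (|u x| ^ (p - 2) * u x) = |u x| ^ p := by
      have h := Real.rpow_add' (abs_nonneg (u x)) (y := p - 2) (z := 2) (by linarith)
      rw [sub_add_cancel, Real.rpow_two, sq_abs] at h
      rw [h]
      ring
    rw [integral_mul_mul_lapl' hχ hχc hu2 hv,
      integral_mul_mul_lapl (hχ.of_le (by norm_num)) hχc hu1 hu2] at key
    simp only [hpow, pderiv_const_mul_comp_smul hb1, pderiv_const_mul_comp_smul (hb' _),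
      ← pow_two] at key
    exact key

lemma directional_pohozaev_identity (hp : 2 < p) (hu : ContDiff ℝ 4 u)
    (h0 : Integrable fun x => u x ^ 2) (h1 : ∀ i, Integrable fun x => pderiv i u x ^ 2)
    (h2 : Integrable fun x => lapl u x ^ 2) (h3 : Integrable fun x => |u x| ^ p)
    (heq : ∀ x, lapl (lapl u) x + μ * lapl u x - lam * u x = |u x| ^ (p - 2) * u x)
    (i : Fin N) :
    2 * (∫ x, pderiv i (pderiv i u) x * lapl u x) - 1 / 2 * (∫ x, lapl u x ^ 2) +
      μ * (-(∫ x, pderiv i u x ^ 2) + 1 / 2 * ∑ j, ∫ x, pderiv j u x ^ 2) +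
        lam / 2 * (∫ x, u x ^ 2) + 1 / p * (∫ x, |u x| ^ p) = 0 := by
  let Φ : EuclideanSpace ℝ (Fin N) → ℝ := fun x => cutoff N x * x i
  have hcoord : ContDiff ℝ 2 fun x : EuclideanSpace ℝ (Fin N) => x i :=
    (EuclideanSpace.proj (𝕜 := ℝ) i).contDiff
  have hb : ContDiff ℝ 2 Φ := (cutoff N).contDiff.mul hcoord
  have hb1 : ContDiff ℝ 1 Φ := hb.of_le (by norm_num)
  have hbc : HasCompactSupport Φ := (cutoff N).hasCompactSupport.mul_right
  have hΦ0 (j : Fin N) : pderiv j Φ 0 = if j = i then 1 else 0 := by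
    have hj : pderiv j (fun x : EuclideanSpace ℝ (Fin N) => x i) 0 = if j = i then 1 else 0 := by
      change fderiv ℝ (EuclideanSpace.proj (𝕜 := ℝ) i) 0 _ = _
      rw [ContinuousLinearMap.fderiv]
      simp [eq_comm]
    rw [pderiv_mul (cutoff N).contDiff (hcoord.of_le (by norm_num)), hj, cutoff_zero]
    simp
  have hb' (j : Fin N) : ContDiff ℝ 1 (pderiv j Φ) := hb.pderiv (by norm_num) j
  have hu2 : ContDiff ℝ 2 u := hu.of_le (by norm_num)
  have hu1 : ContDiff ℝ 1 u := hu.of_le (by norm_num)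
  have hu' (j : Fin N) : ContDiff ℝ 1 (pderiv j u) := hu2.pderiv (by norm_num) j
  have hv : ContDiff ℝ 2 (lapl u) := hu.lapl (by norm_num)
  have hid := tendsto_id_nhdsGT_zero
  have hone := tendsto_inv_mul_self_nhdsGT_zero
  have t1 := tendsto_finsetSum Finset.univ fun (j : Fin N) _ =>
    tendsto_integral_const_mul_comp_smul_mul ((hb' j).continuous_pderiv j)
      ((hbc.pderiv j).pderiv j)
      (integrable_mul_of_integrable_sq (hu' i).continuous hv.continuous (h1 i) h2) (hone.mul hid)
  have t2 := tendsto_finsetSum Finset.univ fun (j : Fin N) _ =>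
    tendsto_integral_const_mul_comp_smul_mul (hb1.continuous_pderiv j) (hbc.pderiv j)
      (integrable_mul_of_integrable_sq ((hu' i).continuous_pderiv j) hv.continuous
        (integrable_pderiv_pderiv_sq (hu.of_le (by norm_num)) h1 h2 i j) h2) hone
  have t3 := tendsto_integral_const_mul_comp_smul_mul (hb1.continuous_pderiv i) (hbc.pderiv i) h2
    hone
  have t4 := tendsto_finsetSum Finset.univ fun (j : Fin N) _ =>
    tendsto_integral_const_mul_comp_smul_mul (hb1.continuous_pderiv j) (hbc.pderiv j)
      (integrable_mul_of_integrable_sq (hu' i).continuous (hu' j).continuous (h1 i) (h1 j)) hone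
  have t5 := tendsto_finsetSum Finset.univ fun (j : Fin N) _ =>
    tendsto_integral_const_mul_comp_smul_mul (hb1.continuous_pderiv i) (hbc.pderiv i) (h1 j) hone
  have t6 := tendsto_integral_const_mul_comp_smul_mul (hb1.continuous_pderiv i) (hbc.pderiv i) h0
    hone
  have t7 := tendsto_integral_const_mul_comp_smul_mul (hb1.continuous_pderiv i) (hbc.pderiv i) h3
    hone
  have hlim := ((((t1.add (t2.const_mul 2)).sub (t3.const_mul (1 / 2))).add
    ((t4.neg.add (t5.const_mul (1 / 2))).const_mul μ)).sub
      ((t6.const_mul (-(1 / 2))).const_mul lam)).sub (t7.const_mul (-(1 / p)))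
  have hzero := tendsto_nhds_unique_of_eventuallyEq hlim (tendsto_const_nhds (x := (0 : ℝ))) ?_
  · simp only [hΦ0, mul_zero, zero_mul, Finset.sum_const_zero, one_mul, ite_mul, one_pow,
      Finset.sum_ite_eq', Finset.mem_univ, if_true, ← pow_two] at hzero
    linarith
  · filter_upwards [self_mem_nhdsWithin] with ε (hε : 0 < ε)
    have hχ := hb.const_mul_comp_smul ε⁻¹ ε
    have hχ1 := hb1.const_mul_comp_smul ε⁻¹ ε
    have hχc := hbc.const_mul_comp_smul ε⁻¹ hε.ne'
    have key := integral_mul_mul_equation hp hu heq hχ.continuous hχc (hu' i).continuous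
    have hself := integral_mul_mul_pderiv_self hχ1 hχc hu1 i
    simp only [mul_comm (u _)] at hself
    rw [integral_mul_pderiv_mul_lapl_lapl hχ hχc hu, integral_mul_pderiv_mul_lapl hχ1 hχc hu2,
      integral_mul_pderiv_mul_abs_rpow (by linarith) hχ1 hχc hu1, hself] at key
    simp only [pderiv_const_mul_comp_smul hb1, pderiv_const_mul_comp_smul (hb' _)] at key
    exact key

end Equation

theorem stmt_5 {N : ℕ} (hN : 1 ≤ N) (u : EuclideanSpace ℝ (Fin N) → ℝ) (μ lam p : ℝ)
    (hlam : lam < 0) (hp : 2 < p) (hp4 : 5 ≤ N → p < 2 * N / ((N : ℝ) - 4))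
    (hu : ContDiff ℝ 4 u)
    (hi0 : Integrable (fun x => (u x) ^ 2))
    (hi1 : Integrable (fun x => ‖gradient u x‖ ^ 2))
    (hi2 : Integrable (fun x => (lapl u x) ^ 2))
    (hi3 : Integrable (fun x => |u x| ^ p))
    (heq : ∀ x, lapl (fun y => lapl u y) x + μ * lapl u x - lam * u x = |u x| ^ (p - 2) * u x) :
    2 * (∫ x, (lapl u x) ^ 2) - μ * (∫ x, ‖gradient u x‖ ^ 2) -
      2 * ((N : ℝ) * (p - 2) / (4 * p)) * (∫ x, |u x| ^ p) = 0 := by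
  have hu2 : ContDiff ℝ 2 u := hu.of_le (by norm_num)
  have hu' (j : Fin N) : ContDiff ℝ 1 (pderiv j u) := hu2.pderiv (by norm_num) j
  have hv : Continuous (lapl u) := (hu.lapl (m := 2) (by norm_num)).continuous
  have h1 (i : Fin N) : Integrable fun x => pderiv i u x ^ 2 := by
    refine hi1.mono' ((hu' i).continuous.pow 2).aestronglyMeasurable
      (Eventually.of_forall fun x => ?_)
    rw [Real.norm_of_nonneg (sq_nonneg _), norm_gradient_sq]
    exact Finset.single_le_sum (f := fun j => pderiv j u x ^ 2) (fun j _ => sq_nonneg _)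
      (Finset.mem_univ i)
  have hgrad : ∫ x, ‖gradient u x‖ ^ 2 = ∑ i, ∫ x, pderiv i u x ^ 2 := by
    simp only [norm_gradient_sq]
    exact integral_finsetSum _ fun i _ => h1 i
  have hlapl : ∑ i, ∫ x, pderiv i (pderiv i u) x * lapl u x = ∫ x, lapl u x ^ 2 := by
    rw [← integral_finsetSum _ fun i _ => integrable_mul_of_integrable_sq
      ((hu' i).continuous_pderiv i) hv
      (integrable_pderiv_pderiv_sq (hu.of_le (by norm_num)) h1 hi2 i i) hi2]
    refine integral_congr_ae (Eventually.of_forall fun x => ?_)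
    simp only [← Finset.sum_mul, pow_two]
    congr 1
    rw [lapl_eq_sum_pderiv hu2]
  have henergy := energy_identity hp hu hi0 h1 hi2 hi3 heq
  have hpoh := Finset.sum_congr rfl fun (i : Fin N) (_ : i ∈ Finset.univ) =>
    directional_pohozaev_identity hp hu hi0 h1 hi2 hi3 heq i
  simp only [Finset.sum_add_distrib, Finset.sum_sub_distrib, ← Finset.mul_sum, hlapl,
    Finset.sum_neg_distrib, Finset.sum_const, Finset.card_univ, Fintype.card_fin, nsmul_eq_mul,
    mul_zero] at hpoh
  rw [hgrad]
  have hp0 : p ≠ 0 := by linarith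
  have hγ : 2 * ((N : ℝ) * (p - 2) / (4 * p)) = N / 2 - N * (1 / p) := by
    field_simp
    ring
  rw [hγ]
  linear_combination hpoh + (N : ℝ) / 2 * henergy
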